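/- arXiv:2106.03107 — 2 statements merged into one kernel-verified Lean document; each statement's English description precedes it below -/
import Mathlib

section
/- For every integer k ≥ 1, the k-adaptability value admits the convexified reformulation: adapt(k) = inf over x ∈ X and over y in the set of convex combinations of at most k points of Y(x) of max_{ξ∈U} (dᵀx + ξᵀy). -/
open scoped BigOperators

/-- Dot product of two vectors in `ℝ^ν`. -/
noncomputable def dot {ν : ℕ} (c x : Fin ν → ℝ) : ℝ := ∑ j, c j * x j

/-- `convComb S k` is the set of all convex combinations of at most `k` points of `S`. -/
def convComb {ν : ℕ} (S : Set (Fin ν → ℝ)) (k : ℕ) : Set (Fin ν → ℝ) :=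
  { x | ∃ (xs : Fin k → (Fin ν → ℝ)) (lam : Fin k → ℝ),
      (∀ i, xs i ∈ S) ∧ (∀ i, 0 ≤ lam i) ∧ (∑ i, lam i) = 1 ∧
      x = ∑ i, lam i • xs i }

/-- `‖y‖₀`, the number of nonzero entries of `y`, as a real number. -/
noncomputable def zeroNorm {ν : ℕ} (y : Fin ν → ℝ) : ℝ :=
  ((Finset.univ.filter (fun j => y j ≠ 0)).card : ℝ)

/-- The `k`-adaptability value
`adapt(k) = inf_{x ∈ X, y¹,…,y^k ∈ Y(x)} max_{ξ ∈ U} min_{i=1,…,k} (dᵀx + ξᵀyⁱ)`. -/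
noncomputable def adaptVal {μ ν : ℕ} (X : Set (Fin μ → ℝ)) (d : Fin μ → ℝ)
    (Y : (Fin μ → ℝ) → Set (Fin ν → ℝ)) (U : Set (Fin ν → ℝ)) (k : ℕ) : ℝ :=
  sInf { v : ℝ | ∃ x ∈ X, ∃ ys : Fin k → (Fin ν → ℝ), (∀ i, ys i ∈ Y x) ∧
    v = sSup ((fun ξ => dot d x + ⨅ i, dot ξ (ys i)) '' U) }

/-- The two-stage robust value
`opt(2RO) = inf_{x ∈ X} max_{ξ ∈ U} min_{y ∈ Y(x)} (dᵀx + ξᵀy)`. -/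
noncomputable def twoStageVal {μ ν : ℕ} (X : Set (Fin μ → ℝ)) (d : Fin μ → ℝ)
    (Y : (Fin μ → ℝ) → Set (Fin ν → ℝ)) (U : Set (Fin ν → ℝ)) : ℝ :=
  sInf { v : ℝ | ∃ x ∈ X, v = sSup ((fun ξ => dot d x + ⨅ y : (Y x), dot ξ (y : Fin ν → ℝ)) '' U) }

theorem dot_sum_smul {ν : ℕ} {ι : Type*} [Fintype ι] (ξ : Fin ν → ℝ) (lam : ι → ℝ)
    (ys : ι → Fin ν → ℝ) :
    dot ξ (∑ i, lam i • ys i) = ∑ i, lam i * dot ξ (ys i) := by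
  simp only [dot, Finset.sum_apply, Pi.smul_apply, smul_eq_mul, Finset.mul_sum]
  rw [Finset.sum_comm]
  exact Finset.sum_congr rfl fun _ _ => Finset.sum_congr rfl fun _ _ => by ring

theorem continuous_dot_left {ν : ℕ} (y : Fin ν → ℝ) : Continuous fun ξ => dot ξ y := by
  unfold dot
  fun_prop

theorem dot_comb_left {ν : ℕ} (ξ η y : Fin ν → ℝ) (s t : ℝ) :
    dot (s • ξ + t • η) y = s * dot ξ y + t * dot η y := by
  simp only [dot, Pi.add_apply, Pi.smul_apply, smul_eq_mul, Finset.mul_sum,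
    ← Finset.sum_add_distrib]
  exact Finset.sum_congr rfl fun _ _ => by ring

theorem iInf_dot_le_dot_sum_smul {ν : ℕ} {ι : Type*} [Fintype ι] (ξ : Fin ν → ℝ)
    {lam : ι → ℝ} (hlam : lam ∈ stdSimplex ℝ ι) (ys : ι → Fin ν → ℝ) :
    ⨅ i, dot ξ (ys i) ≤ dot ξ (∑ i, lam i • ys i) := by
  rw [dot_sum_smul]
  calc ⨅ i, dot ξ (ys i) = ∑ i, lam i * ⨅ i, dot ξ (ys i) := by
        rw [← Finset.sum_mul, hlam.2, one_mul]
    _ ≤ ∑ i, lam i * dot ξ (ys i) := Finset.sum_le_sum fun i _ =>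
        mul_le_mul_of_nonneg_left (ciInf_le (Set.finite_range _).bddBelow i) (hlam.1 i)

/-- Convexifying finitely many recourse decisions does not decrease the worst-case cost. -/
theorem sSup_iInf_dot_le {ν : ℕ} {ι : Type*} [Fintype ι] {U : Set (Fin ν → ℝ)}
    (hUne : U.Nonempty) (hUcomp : IsCompact U) (c : ℝ) {lam : ι → ℝ}
    (hlam : lam ∈ stdSimplex ℝ ι) (ys : ι → Fin ν → ℝ) :
    sSup ((fun ξ => c + ⨅ i, dot ξ (ys i)) '' U) ≤
      sSup ((fun ξ => c + dot ξ (∑ i, lam i • ys i)) '' U) := by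
  refine csSup_le (hUne.image _) ?_
  rintro _ ⟨ξ, hξ, rfl⟩
  have hbdd : BddAbove ((fun ξ => c + dot ξ (∑ i, lam i • ys i)) '' U) :=
    (hUcomp.image (continuous_const.add (continuous_dot_left _))).bddAbove
  exact (add_le_add_right (iInf_dot_le_dot_sum_smul ξ hlam ys) c).trans
    (le_csSup hbdd ⟨ξ, hξ, rfl⟩)

/-- A saddle point of the bilinear cost on `stdSimplex × U`, from Sion's minimax theorem. -/
theorem exists_saddle_dot {ν : ℕ} {ι : Type*} [Fintype ι] [Nonempty ι] {U : Set (Fin ν → ℝ)}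
    (hUne : U.Nonempty) (hUcomp : IsCompact U) (hUconv : Convex ℝ U) (ys : ι → Fin ν → ℝ) :
    ∃ lam ∈ stdSimplex ℝ ι, ∃ η ∈ U, ∀ ξ ∈ U,
      dot ξ (∑ i, lam i • ys i) ≤ ⨅ i, dot η (ys i) := by
  classical
  obtain ⟨lam, hlam, η, hη, h⟩ := Sion.exists_isSaddlePointOn
    (X := stdSimplex ℝ ι) (Y := U) (f := fun lam ξ => dot ξ (∑ i, lam i • ys i))
    ⟨_, single_mem_stdSimplex ℝ (Classical.arbitrary ι)⟩ (convex_stdSimplex ℝ ι)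
    (isCompact_stdSimplex ℝ ι)
    (fun ξ _ => by
      simp only [dot_sum_smul]
      exact Continuous.lowerSemicontinuous (by fun_prop) |>.lowerSemicontinuousOn _)
    (fun ξ _ => by
      refine ConvexOn.quasiconvexOn ⟨convex_stdSimplex ℝ ι, fun a _ b _ s t _ _ _ => le_of_eq ?_⟩
      simp only [dot_sum_smul, Pi.add_apply, Pi.smul_apply, smul_eq_mul, Finset.mul_sum,
        ← Finset.sum_add_distrib]
      exact Finset.sum_congr rfl fun _ _ => by ring)
    hUconv hUne hUcomp
    (fun lam _ => (continuous_dot_left _).upperSemicontinuous.upperSemicontinuousOn _)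
    (fun lam _ => ConcaveOn.quasiconcaveOn
      ⟨hUconv, fun ξ _ η _ s t _ _ _ => (dot_comb_left ξ η _ s t).ge⟩)
  refine ⟨lam, hlam, η, hη, fun ξ hξ => le_ciInf fun i => ?_⟩
  have hi := h (Pi.single i 1) (single_mem_stdSimplex ℝ i) ξ hξ
  simpa [dot_sum_smul, Pi.single_apply] using hi

/-- The worst-case cost of finitely many recourse decisions is attained by one of their convex
combinations. -/
theorem exists_sSup_iInf_dot_eq {ν : ℕ} {ι : Type*} [Fintype ι] [Nonempty ι]
    {U : Set (Fin ν → ℝ)} (hUne : U.Nonempty) (hUcomp : IsCompact U) (hUconv : Convex ℝ U)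
    (c : ℝ) (ys : ι → Fin ν → ℝ) :
    ∃ lam ∈ stdSimplex ℝ ι, sSup ((fun ξ => c + ⨅ i, dot ξ (ys i)) '' U) =
      sSup ((fun ξ => c + dot ξ (∑ i, lam i • ys i)) '' U) := by
  obtain ⟨lam, hlam, η, hη, h⟩ := exists_saddle_dot hUne hUcomp hUconv ys
  refine ⟨lam, hlam, (sSup_iInf_dot_le hUne hUcomp c hlam ys).antisymm ?_⟩
  have hbdd : BddAbove ((fun ξ => c + ⨅ i, dot ξ (ys i)) '' U) := by
    refine ⟨c + ⨅ i, dot η (ys i), ?_⟩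
    rintro _ ⟨ξ, hξ, rfl⟩
    exact add_le_add_right ((iInf_dot_le_dot_sum_smul ξ hlam ys).trans (h ξ hξ)) c
  refine csSup_le (hUne.image _) ?_
  rintro _ ⟨ξ, hξ, rfl⟩
  exact (add_le_add_right (h ξ hξ) c).trans (le_csSup hbdd ⟨η, hη, rfl⟩)

/-- Coinitial subsets of the reals have the same infimum, also when they are empty or unbounded. -/
theorem Real.sInf_eq_of_subset_of_forall_exists_le {A B : Set ℝ} (hAB : A ⊆ B)
    (hBA : ∀ b ∈ B, ∃ a ∈ A, a ≤ b) : sInf A = sInf B := by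
  rcases A.eq_empty_or_nonempty with rfl | hA
  · rcases B.eq_empty_or_nonempty with rfl | ⟨b, hb⟩
    · rfl
    · simpa using hBA b hb
  by_cases hbdd : BddBelow A
  · have hlow : ∀ b ∈ B, sInf A ≤ b := fun b hb =>
      let ⟨_, ha, hab⟩ := hBA b hb
      (csInf_le hbdd ha).trans hab
    exact (le_csInf (hA.mono hAB) hlow).antisymm (csInf_le_csInf ⟨_, hlow⟩ hA hAB)
  · rw [Real.sInf_of_not_bddBelow hbdd,
      Real.sInf_of_not_bddBelow fun hB => hbdd (hB.mono hAB)]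

/-- For every `k ≥ 1`, the `k`-adaptability value admits the convexified
reformulation `adapt(k) = inf_{x ∈ X, y ∈ Y(x)(k)} max_{ξ ∈ U} (dᵀx + ξᵀy)`, where
`Y(x)(k)` is the set of convex combinations of at most `k` points of `Y(x)`. -/
theorem stmt13 (m n : ℕ) (hm : 0 < m) (hn : 0 < n)
    (X : Set (Fin m → ℝ)) (hXne : X.Nonempty) (hXcomp : IsCompact X)
    (d : Fin m → ℝ)
    (Y : (Fin m → ℝ) → Set (Fin n → ℝ))
    (hYfin : ∀ x ∈ X, (Y x).Finite) (hYne : ∀ x ∈ X, (Y x).Nonempty)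
    (hYbin : ∀ x ∈ X, ∀ y ∈ Y x, ∀ j, y j = 0 ∨ y j = 1)
    (U : Set (Fin n → ℝ)) (hUne : U.Nonempty) (hUcomp : IsCompact U) (hUconv : Convex ℝ U) :
    ∀ k : ℕ, 1 ≤ k →
      adaptVal X d Y U k =
        sInf { v : ℝ | ∃ x ∈ X, ∃ y ∈ convComb (Y x) k,
          v = sSup ((fun ξ => dot d x + dot ξ y) '' U) } := by
  intro k hk
  have : Nonempty (Fin k) := ⟨⟨0, hk⟩⟩
  refine Real.sInf_eq_of_subset_of_forall_exists_le ?_ ?_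
  · rintro _ ⟨x, hx, ys, hys, rfl⟩
    obtain ⟨lam, hlam, h⟩ := exists_sSup_iInf_dot_eq hUne hUcomp hUconv (dot d x) ys
    exact ⟨x, hx, _, ⟨ys, lam, hys, hlam.1, hlam.2, rfl⟩, h⟩
  · rintro _ ⟨x, hx, _, ⟨ys, lam, hys, hlam, hsum, rfl⟩, rfl⟩
    exact ⟨_, ⟨x, hx, ys, hys, rfl⟩, sSup_iInf_dot_le hUne hUcomp _ ⟨hlam, hsum⟩ ys⟩
end

section
/- For all integers s, k with 1 ≤ s < k ≤ n+1 it holds that adapt(s) − adapt(k) ≤ M·(k−s)/(s+1), where M := M_∞·p̄ − m_∞·p. -/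
open scoped BigOperators

/-- A separation form of the minimax theorem: if at each point of a convex set some coordinate is
nonpositive, then one convex combination of the coordinates is nonpositive on the whole set. -/
theorem Convex.exists_weights_sum_mul_nonpos {ι : Type*} [Fintype ι] {C : Set (ι → ℝ)}
    (hC : Convex ℝ C) (hne : C.Nonempty) (h : ∀ c ∈ C, ∃ i, c i ≤ 0) :
    ∃ w : ι → ℝ, (∀ i, 0 ≤ w i) ∧ ∑ i, w i = 1 ∧ ∀ c ∈ C, ∑ i, w i * c i ≤ 0 := by
  classical
  have hKopen : IsOpen {v : ι → ℝ | ∀ i, 0 < v i} := by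
    simp only [Set.ofPred_forall]
    exact isOpen_iInter_of_finite fun i => isOpen_lt continuous_const (continuous_apply i)
  have hKconv : Convex ℝ {v : ι → ℝ | ∀ i, 0 < v i} := by
    simp only [Set.ofPred_forall]
    exact convex_iInter fun i => convex_halfSpace_gt (LinearMap.proj i).isLinear 0
  have hdisj : Disjoint {v : ι → ℝ | ∀ i, 0 < v i} C := by
    rw [Set.disjoint_left]
    intro v hv hvC
    obtain ⟨i, hi⟩ := h v hvC
    exact absurd (hv i) (not_lt.mpr hi)
  obtain ⟨f, u, hfK, hfC⟩ := geometric_hahn_banach_open hKconv hKopen hC hdisj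
  have hf : ∀ v : ι → ℝ, f v = ∑ i, f (Pi.single i 1) * v i := by
    intro v
    conv_lhs => rw [← Finset.univ_sum_single v]
    rw [map_sum]
    refine Finset.sum_congr rfl fun i _ => ?_
    have : Pi.single i (v i) = v i • (Pi.single i 1 : ι → ℝ) := by
      rw [← Pi.single_smul, smul_eq_mul, mul_one]
    rw [this, map_smul, smul_eq_mul, mul_comm]
  have hu : 0 ≤ u := by
    by_contra! hu
    have h1 : f 1 < u := hfK 1 fun i => one_pos
    have h1' : f 1 < 0 := h1.trans hu
    have h2 : f ((u / (2 * f 1)) • 1) < u := hfK _ fun i => by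
      simpa using div_pos_of_neg_of_neg hu (by linarith)
    rw [map_smul, smul_eq_mul] at h2
    have : u / (2 * f 1) * f 1 = u / 2 := by
      have := h1'.ne
      field_simp
    linarith
  have hw : ∀ i, f (Pi.single i 1) ≤ 0 := by
    intro i
    by_contra! hi
    have h2 : f ((|u - f 1| / f (Pi.single i 1)) • Pi.single i 1 + 1) < u := hfK _ fun j => by
      have hj : (0 : ℝ) ≤ (Pi.single i 1 : ι → ℝ) j := by
        rw [Pi.single_apply]; split_ifs <;> norm_num
      have := mul_nonneg (div_nonneg (abs_nonneg (u - f 1)) hi.le) hj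
      simp only [Pi.add_apply, Pi.smul_apply, Pi.one_apply, smul_eq_mul]
      linarith
    rw [map_add, map_smul, smul_eq_mul, div_mul_cancel₀ _ hi.ne'] at h2
    linarith [le_abs_self (u - f 1)]
  have hW : ∑ i, f (Pi.single i 1) < 0 := by
    refine lt_of_le_of_ne (Finset.sum_nonpos fun i _ => hw i) fun h0 => ?_
    have hz := (Finset.sum_eq_zero_iff_of_nonpos fun i _ => hw i).mp h0
    have hf0 : ∀ v, f v = 0 := fun v => by
      rw [hf]; exact Finset.sum_eq_zero fun i hi => by rw [hz i hi, zero_mul]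
    obtain ⟨c, hc⟩ := hne
    have h1 := hfK 1 fun i => one_pos
    have h2 := hfC c hc
    rw [hf0] at h1 h2
    linarith
  refine ⟨fun i => f (Pi.single i 1) / ∑ j, f (Pi.single j 1),
    fun i => div_nonneg_of_nonpos (hw i) hW.le, ?_, fun c hc => ?_⟩
  · rw [← Finset.sum_div, div_self hW.ne]
  · have : ∑ i, f (Pi.single i 1) / (∑ j, f (Pi.single j 1)) * c i
        = f c / ∑ j, f (Pi.single j 1) := by
      rw [hf c, Finset.sum_div]
      exact Finset.sum_congr rfl fun i _ => by ring
    rw [this]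
    exact div_nonpos_of_nonneg_of_nonpos (hu.trans (hfC c hc)) hW.le

/-- Some `r`-element subset carries at least the average share of a sum. -/
theorem Finset.exists_subset_card_eq_mul_sum_le {ι : Type*} (w : ι → ℝ) (T : Finset ι) (r : ℕ)
    (hr : r ≤ T.card) :
    ∃ S ⊆ T, S.card = r ∧ (r : ℝ) * ∑ i ∈ T, w i ≤ T.card * ∑ i ∈ S, w i := by
  classical
  induction hN : T.card - r generalizing r with
  | zero =>
    obtain rfl : r = T.card := by omega
    exact ⟨T, subset_rfl, rfl, le_rfl⟩
  | succ N ih =>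
    obtain ⟨S, hST, hScard, hS⟩ := ih (r + 1) (by omega) (by omega)
    obtain ⟨a, haS, ha⟩ := S.exists_min_image w (Finset.card_pos.mp (by omega))
    refine ⟨S.erase a, (S.erase_subset a).trans hST, ?_, ?_⟩
    · rw [Finset.card_erase_of_mem haS, hScard, Nat.add_sub_cancel]
    · have hsum := Finset.add_sum_erase S w haS
      have hmin := Finset.card_nsmul_le_sum S w (w a) ha
      rw [hScard, nsmul_eq_mul] at hmin
      push_cast at hS hmin
      have hr0 : (0 : ℝ) ≤ r := r.cast_nonneg
      have h1 : (r : ℝ) * ∑ i ∈ S, w i ≤ (r + 1) * ∑ i ∈ S.erase a, w i := by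
        rw [← hsum] at hmin ⊢
        linarith
      have h2 := mul_le_mul_of_nonneg_left hS hr0
      have h3 := mul_le_mul_of_nonneg_left h1 (T.card.cast_nonneg (α := ℝ))
      have : ((r : ℝ) + 1) * (r * ∑ i ∈ T, w i) ≤ (r + 1) * (T.card * ∑ i ∈ S.erase a, w i) := by
        linarith
      exact le_of_mul_le_mul_left this (by positivity)

/-- Among `k` real functions on a convex set, affine there, some `s` have a pointwise minimum that
exceeds the minimum of all `k` by at most the fraction `(k - s) / k` of their range. -/
theorem exists_embedding_forall_exists_dot_le {n k s : ℕ} (hs : 1 ≤ s) (hsk : s ≤ k)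
    {U : Set (Fin n → ℝ)} (hUne : U.Nonempty) (hUconv : Convex ℝ U)
    (ys : Fin k → Fin n → ℝ) {a b V : ℝ} (hab : ∀ ξ ∈ U, ∀ i, a ≤ dot ξ (ys i) ∧ dot ξ (ys i) ≤ b)
    (hV : ∀ ξ ∈ U, ∃ i, dot ξ (ys i) ≤ V) :
    ∃ e : Fin s → Fin k, ∀ ξ ∈ U, ∃ j,
      dot ξ (ys (e j)) ≤ V + (b - a) * (((k : ℝ) - s) / k) := by
  classical
  have hk : (0 : ℝ) < k := by exact_mod_cast (by omega : 0 < k)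
  let g : (Fin n → ℝ) → Fin k → ℝ := fun ξ i => dot ξ (ys i) - V
  have hC : Convex ℝ (g '' U) := by
    rintro _ ⟨ξ, hξ, rfl⟩ _ ⟨η, hη, rfl⟩ α β hα hβ hαβ
    refine ⟨α • ξ + β • η, hUconv hξ hη hα hβ hαβ, ?_⟩
    ext i
    have : dot (α • ξ + β • η) (ys i) = α * dot ξ (ys i) + β * dot η (ys i) := by
      simp only [dot, Finset.mul_sum, ← Finset.sum_add_distrib, Pi.add_apply, Pi.smul_apply,
        smul_eq_mul]
      exact Finset.sum_congr rfl fun j _ => by ring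
    simp only [g, Pi.add_apply, Pi.smul_apply, smul_eq_mul, this]
    linear_combination V * hαβ
  obtain ⟨w, hw0, hw1, hw⟩ := hC.exists_weights_sum_mul_nonpos (hUne.image g) (by
    rintro _ ⟨ξ, hξ, rfl⟩
    obtain ⟨i, hi⟩ := hV ξ hξ
    exact ⟨i, sub_nonpos.mpr hi⟩)
  obtain ⟨S, -, hScard, hS⟩ :=
    Finset.exists_subset_card_eq_mul_sum_le w Finset.univ s (by simpa using hsk)
  rw [hw1, mul_one, Finset.card_fin] at hS
  refine ⟨S.orderEmbOfFin hScard, fun ξ hξ => ?_⟩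
  obtain ⟨i₀, hi₀, hmin⟩ :=
    S.exists_min_image (fun i => dot ξ (ys i)) (Finset.card_pos.mp (by omega))
  have hrange : i₀ ∈ Set.range (S.orderEmbOfFin hScard) := by
    rw [Finset.range_orderEmbOfFin]; exact hi₀
  obtain ⟨j, hj⟩ := hrange
  refine ⟨j, ?_⟩
  rw [hj]
  have hsum := hw _ ⟨ξ, hξ, rfl⟩
  have hsplit : ∑ i, w i = ∑ i ∈ S, w i + ∑ i ∈ Sᶜ, w i := (Finset.sum_add_sum_compl S w).symm
  have htail : ∑ i ∈ Sᶜ, w i ≤ ((k : ℝ) - s) / k := by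
    rw [le_div_iff₀ hk]
    have : ∑ i ∈ Sᶜ, w i = 1 - ∑ i ∈ S, w i := by linarith
    rw [this]
    linarith
  have h1 : ∑ i ∈ S, w i * (dot ξ (ys i₀) - V) ≤ ∑ i ∈ S, w i * g ξ i :=
    Finset.sum_le_sum fun i hi =>
      mul_le_mul_of_nonneg_left (sub_le_sub_right (hmin i hi) V) (hw0 i)
  have h2 : ∑ i ∈ Sᶜ, w i * (dot ξ (ys i₀) - V - (b - a)) ≤ ∑ i ∈ Sᶜ, w i * g ξ i :=
    Finset.sum_le_sum fun i _ => mul_le_mul_of_nonneg_left (by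
      have := (hab ξ hξ i).1
      have := (hab ξ hξ i₀).2
      simp only [g]
      linarith) (hw0 i)
  rw [← Finset.sum_mul] at h1 h2
  rw [← Finset.sum_add_sum_compl S] at hsum
  have hba : 0 ≤ b - a := by linarith [(hab ξ hξ i₀).1, (hab ξ hξ i₀).2]
  have h3 := mul_le_mul_of_nonneg_left htail hba
  have h4 : (∑ i ∈ S, w i + ∑ i ∈ Sᶜ, w i) * (dot ξ (ys i₀) - V)
      = dot ξ (ys i₀) - V := by rw [← hsplit, hw1, one_mul]
  linarith

theorem sum_eq_zeroNorm {n : ℕ} {y : Fin n → ℝ} (hy : ∀ j, y j = 0 ∨ y j = 1) :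
    ∑ j, y j = zeroNorm y := by
  rw [zeroNorm, Finset.card_filter, Nat.cast_sum]
  refine Finset.sum_congr rfl fun j _ => ?_
  rcases hy j with h | h <;> simp [h]

theorem mul_zeroNorm_le_dot {n : ℕ} {ξ y : Fin n → ℝ} {l : ℝ} (hξ : ∀ j, l ≤ ξ j)
    (hy : ∀ j, y j = 0 ∨ y j = 1) : l * zeroNorm y ≤ dot ξ y := by
  rw [← sum_eq_zeroNorm hy, dot, Finset.mul_sum]
  refine Finset.sum_le_sum fun j _ => mul_le_mul_of_nonneg_right (hξ j) ?_
  rcases hy j with h | h <;> simp [h]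

theorem dot_le_mul_zeroNorm {n : ℕ} {ξ y : Fin n → ℝ} {L : ℝ} (hξ : ∀ j, ξ j ≤ L)
    (hy : ∀ j, y j = 0 ∨ y j = 1) : dot ξ y ≤ L * zeroNorm y := by
  rw [← sum_eq_zeroNorm hy, dot, Finset.mul_sum]
  refine Finset.sum_le_sum fun j _ => mul_le_mul_of_nonneg_right (hξ j) ?_
  rcases hy j with h | h <;> simp [h]

/-- For `1 ≤ s < k ≤ n+1`, `adapt(s) − adapt(k) ≤ M·(k−s)/(s+1)`
with `M = M_∞·p̄ − m_∞·p`. -/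
theorem stmt15 (m n : ℕ) (hm : 0 < m) (hn : 0 < n)
    (X : Set (Fin m → ℝ)) (hXne : X.Nonempty) (hXcomp : IsCompact X)
    (d : Fin m → ℝ)
    (Y : (Fin m → ℝ) → Set (Fin n → ℝ))
    (hYfin : ∀ x ∈ X, (Y x).Finite) (hYne : ∀ x ∈ X, (Y x).Nonempty)
    (hYbin : ∀ x ∈ X, ∀ y ∈ Y x, ∀ j, y j = 0 ∨ y j = 1)
    (U : Set (Fin n → ℝ)) (hUne : U.Nonempty) (hUcomp : IsCompact U) (hUconv : Convex ℝ U)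
    (m_inf M_inf : ℝ) (hminf : 0 < m_inf) (hmM : m_inf ≤ M_inf)
    (hxi : ∀ ξ ∈ U, ∀ j, m_inf ≤ ξ j ∧ ξ j ≤ M_inf)
    (p pbar : ℝ) (hp0 : 0 ≤ p) (hppbar : p ≤ pbar)
    (hpy : ∀ x ∈ X, ∀ y ∈ Y x, p ≤ zeroNorm y ∧ zeroNorm y ≤ pbar)
    (s k : ℕ) (hs : 1 ≤ s) (hsk : s < k) (hkn : k ≤ n + 1) :
    adaptVal X d Y U s - adaptVal X d Y U k ≤
      (M_inf * pbar - m_inf * p) * (((k : ℝ) - s) / ((s : ℝ) + 1)) := by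
  have hMpos : 0 < M_inf := hminf.trans_le hmM
  have hdot : ∀ x ∈ X, ∀ y ∈ Y x, ∀ ξ ∈ U, m_inf * p ≤ dot ξ y ∧ dot ξ y ≤ M_inf * pbar :=
    fun x hx y hy ξ hξ =>
      ⟨(mul_le_mul_of_nonneg_left (hpy x hx y hy).1 hminf.le).trans
          (mul_zeroNorm_le_dot (fun j => (hxi ξ hξ j).1) (hYbin x hx y hy)),
        (dot_le_mul_zeroNorm (fun j => (hxi ξ hξ j).2) (hYbin x hx y hy)).trans
          (mul_le_mul_of_nonneg_left (hpy x hx y hy).2 hMpos.le)⟩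
  have hM : 0 ≤ M_inf * pbar - m_inf * p :=
    sub_nonneg.mpr (mul_le_mul hmM hppbar hp0 hMpos.le)
  have hiInf : ∀ {r : ℕ} (ys : Fin r → Fin n → ℝ) (ξ : Fin n → ℝ) (i : Fin r),
      ⨅ i, dot ξ (ys i) ≤ dot ξ (ys i) := fun ys ξ i => ciInf_le (Set.finite_range _).bddBelow i
  have hbdd : ∀ {r : ℕ}, 0 < r → ∀ x ∈ X, ∀ ys : Fin r → Fin n → ℝ, (∀ i, ys i ∈ Y x) →
      BddAbove ((fun ξ => dot d x + ⨅ i, dot ξ (ys i)) '' U) := by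
    intro r hr x hx ys hys
    refine ⟨dot d x + M_inf * pbar, ?_⟩
    rintro _ ⟨ξ, hξ, rfl⟩
    exact add_le_add_right ((hiInf ys ξ ⟨0, hr⟩).trans (hdot x hx _ (hys _) ξ hξ).2) _
  have hk0 : 0 < k := by omega
  have : Nonempty (Fin k) := ⟨⟨0, hk0⟩⟩
  have : Nonempty (Fin s) := ⟨⟨0, hs⟩⟩
  rw [sub_le_iff_le_add', ← sub_le_iff_le_add]
  obtain ⟨x₀, hx₀⟩ := hXne
  obtain ⟨y₀, hy₀⟩ := hYne x₀ hx₀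
  refine le_csInf ⟨_, x₀, hx₀, fun _ => y₀, fun _ => hy₀, rfl⟩ ?_
  rintro _ ⟨x, hx, ys, hys, rfl⟩
  set v := sSup ((fun ξ => dot d x + ⨅ i, dot ξ (ys i)) '' U) with hv
  obtain ⟨e, he⟩ := exists_embedding_forall_exists_dot_le (V := v - dot d x) hs hsk.le hUne hUconv
    ys (fun ξ hξ i => hdot x hx (ys i) (hys i) ξ hξ) (fun ξ hξ => by
      obtain ⟨i, hi⟩ := exists_eq_ciInf_of_finite (f := fun i => dot ξ (ys i))
      refine ⟨i, ?_⟩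
      have := le_csSup (hbdd hk0 x hx ys hys) ⟨ξ, hξ, rfl⟩
      simp only [← hv] at this
      linarith)
  have hbelow : BddBelow { v : ℝ | ∃ x ∈ X, ∃ ys : Fin s → (Fin n → ℝ), (∀ i, ys i ∈ Y x) ∧
      v = sSup ((fun ξ => dot d x + ⨅ i, dot ξ (ys i)) '' U) } := by
    have hcont : Continuous fun x : Fin m → ℝ => dot d x := by unfold dot; fun_prop
    obtain ⟨B, hB⟩ := (hXcomp.image hcont).bddBelow
    refine ⟨B + m_inf * p, ?_⟩
    rintro _ ⟨x, hx, ys, hys, rfl⟩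
    obtain ⟨ξ, hξ⟩ := hUne
    exact (add_le_add (hB ⟨x, hx, rfl⟩)
      (le_ciInf fun i => (hdot x hx _ (hys i) ξ hξ).1)).trans
        (le_csSup (hbdd hs x hx ys hys) ⟨ξ, hξ, rfl⟩)
  have hfrac : ((k : ℝ) - s) / k ≤ ((k : ℝ) - s) / (s + 1) := by
    have h1 : (s : ℝ) + 1 ≤ k := by exact_mod_cast hsk
    exact div_le_div_of_nonneg_left (by linarith) (by positivity) h1
  have hbound := mul_le_mul_of_nonneg_left hfrac hM
  rw [sub_le_iff_le_add]
  refine (csInf_le hbelow ⟨x, hx, fun j => ys (e j), fun j => hys (e j), rfl⟩).trans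
    (csSup_le (hUne.image _) ?_)
  rintro _ ⟨ξ, hξ, rfl⟩
  obtain ⟨j, hj⟩ := he ξ hξ
  have := hiInf (fun j => ys (e j)) ξ j
  simp only
  linarith
end
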